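/- arXiv:1506.00949 — 2 statements merged into one kernel-verified Lean document; each statement's English description precedes it below -/
import Mathlib

section
/- Let Γ be a recursive game with {v_n : n ≥ 1} totally bounded for the uniform norm, and set v(x) = limsup_{n→∞} v_n(x). Then for every state x₁ ∈ X there exists a mixed action s*(x₁) ∈ Δ(A(x₁)) such that for every b ∈ B(x₁), E_{q(x₁,s*(x₁),b)}[v(x₂)] ≥ v(x₁). -/
open scoped Classical
open Filter

noncomputable section

/-- A two-player zero-sum stochastic game: a state space `X`, action sets `A`, `B`
with a nonempty finite feasible subset at every state, a payoff function with values
in `[-1,1]`, and a finitely supported transition probability function. -/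
structure StocGame where
  X : Type
  A : Type
  B : Type
  actA : X → Finset A
  actB : X → Finset B
  actA_nonempty : ∀ x, (actA x).Nonempty
  actB_nonempty : ∀ x, (actB x).Nonempty
  g : X → A → B → ℝ
  g_bdd : ∀ x a b, |g x a b| ≤ 1
  q : X → A → B → X → ℝ
  q_nonneg : ∀ x a b y, 0 ≤ q x a b y
  q_finsupp : ∀ x a b, (Function.support (q x a b)).Finite
  q_sum : ∀ x a b, (∑' y, q x a b y) = 1

namespace StocGame

variable (G : StocGame)

/-- A behavior strategy of player 1: to every past history (a chronological list of
(state, action of player 1, action of player 2) triples) and every current state, it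
assigns a mixed action supported on the feasible action set. -/
structure Strategy1 where
  play : List (G.X × G.A × G.B) → G.X → G.A → ℝ
  nonneg : ∀ h x a, 0 ≤ play h x a
  supp : ∀ h x a, a ∉ G.actA x → play h x a = 0
  sum_one : ∀ h x, ∑ a ∈ G.actA x, play h x a = 1

/-- A behavior strategy of player 2. -/
structure Strategy2 where
  play : List (G.X × G.A × G.B) → G.X → G.B → ℝ
  nonneg : ∀ h x b, 0 ≤ play h x b
  supp : ∀ h x b, b ∉ G.actB x → play h x b = 0
  sum_one : ∀ h x, ∑ b ∈ G.actB x, play h x b = 1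

variable {G}

/-- The chronological sequence of states visited along a finite history
(past history together with the current state). -/
def stateSeq (hx : List (G.X × G.A × G.B) × G.X) : List G.X :=
  hx.1.map Prod.fst ++ [hx.2]

/-- A strategy of player 1 which depends on the history only through the sequence of
visited states (and not on past actions). -/
def Strategy1.stateDep (σ : Strategy1 G) : Prop :=
  ∀ h h' x, h.map Prod.fst = h'.map Prod.fst → σ.play h x = σ.play h' x

/-- A strategy of player 2 which depends on the history only through the sequence of
visited states (and not on past actions). -/
def Strategy2.stateDep (τ : Strategy2 G) : Prop :=
  ∀ h h' x, h.map Prod.fst = h'.map Prod.fst → τ.play h x = τ.play h' x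

/-- A pure strategy of player 1. -/
def Strategy1.pure (σ : Strategy1 G) : Prop :=
  ∀ h x, ∃ a ∈ G.actA x, σ.play h x a = 1

/-- A pure strategy of player 2. -/
def Strategy2.pure (τ : Strategy2 G) : Prop :=
  ∀ h x, ∃ b ∈ G.actB x, τ.play h x b = 1

variable (G)

/-- Auxiliary function: the probability of a finite history, the past history being
given in reverse chronological order. -/
def histProbAux (x₁ : G.X) (σ : Strategy1 G) (τ : Strategy2 G) :
    List (G.X × G.A × G.B) → G.X → ℝ
  | [], x => if x = x₁ then 1 else 0
  | (y, a, b) :: rest, x =>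
      histProbAux x₁ σ τ rest y * σ.play rest.reverse y a * τ.play rest.reverse y b *
        G.q y a b x

/-- Probability, in the game starting at `x₁` played with `(σ, τ)`, that the play starts
with the (chronological) past history `h` followed by the current state `x`. -/
def histProb (x₁ : G.X) (σ : Strategy1 G) (τ : Strategy2 G)
    (h : List (G.X × G.A × G.B)) (x : G.X) : ℝ :=
  G.histProbAux x₁ σ τ h.reverse x

/-- Expected payoff of stage `t` in the game starting at `x₁` played with `(σ, τ)`. -/
def stagePayoff (x₁ : G.X) (σ : Strategy1 G) (τ : Strategy2 G) (t : ℕ) : ℝ :=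
  ∑' hx : List (G.X × G.A × G.B) × G.X,
    if hx.1.length + 1 = t then
      G.histProb x₁ σ τ hx.1 hx.2 *
        ∑ a ∈ G.actA hx.2, ∑ b ∈ G.actB hx.2,
          σ.play hx.1 hx.2 a * τ.play hx.1 hx.2 b * G.g hx.2 a b
    else 0

/-- Expected average payoff `γ_n(x₁, σ, τ)` over the `n` first stages. -/
def avgPayoff (x₁ : G.X) (σ : Strategy1 G) (τ : Strategy2 G) (n : ℕ) : ℝ :=
  (n : ℝ)⁻¹ * ∑ t ∈ Finset.Icc 1 n, G.stagePayoff x₁ σ τ t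

/-- Expected `λ`-discounted payoff `γ_λ(x₁, σ, τ)`. -/
def discPayoff (x₁ : G.X) (σ : Strategy1 G) (τ : Strategy2 G) (lam : ℝ) : ℝ :=
  ∑' t : ℕ, lam * (1 - lam) ^ t * G.stagePayoff x₁ σ τ (t + 1)

/-- The value `v_n(x₁)` of the `n`-stage game (by the minmax theorem, the game has a
value, which is then equal to this maxmin). -/
def nValue (n : ℕ) (x₁ : G.X) : ℝ :=
  ⨆ σ : Strategy1 G, ⨅ τ : Strategy2 G, G.avgPayoff x₁ σ τ n

/-- The value `v_λ(x₁)` of the `λ`-discounted game. -/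
def lamValue (lam : ℝ) (x₁ : G.X) : ℝ :=
  ⨆ σ : Strategy1 G, ⨅ τ : Strategy2 G, G.discPayoff x₁ σ τ lam

/-- The pointwise limit superior `v(x) = limsup_n v_n(x)` of the `n`-stage values. -/
def limsupV (x : G.X) : ℝ := Filter.limsup (fun n => G.nValue n x) Filter.atTop

/-- The family `{v_n, n ≥ 1}` is totally bounded for the uniform norm: for every
`ε > 0` there is a finite subfamily within uniform distance `ε` of every member. -/
def TotallyBoundedValues : Prop :=
  ∀ ε > (0 : ℝ), ∃ S : Finset ℕ, (∀ m ∈ S, 1 ≤ m) ∧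
    ∀ n, 1 ≤ n → ∃ m ∈ S, ∀ x, |G.nValue n x - G.nValue m x| ≤ ε

/-- Probability that the sequence of the first states of the play is `s`. -/
def statesProb (x₁ : G.X) (σ : Strategy1 G) (τ : Strategy2 G) (s : List G.X) : ℝ :=
  ∑' hx : List (G.X × G.A × G.B) × G.X,
    if stateSeq hx = s then G.histProb x₁ σ τ hx.1 hx.2 else 0

end StocGame

/-- A two-player zero-sum recursive game: a stochastic game whose state space is
partitioned into active states (where the payoff is `0`) and absorbing states (which
are trapping, with a payoff depending only on the state). -/
structure RecGame extends StocGame where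
  absorbing : X → Prop
  g_active : ∀ x a b, ¬ absorbing x → g x a b = 0
  absorbing_q : ∀ x a b, absorbing x → q x a b x = 1
  absorbing_g : ∀ x a b a' b', absorbing x → g x a b = g x a' b'

namespace RecGame

variable (G : RecGame)

/-- The stage payoff as a function of the state only: `0` on active states, and the
absorbing payoff on absorbing states. -/
def stateg (x : G.X) : ℝ :=
  G.g x (G.actA_nonempty x).choose (G.actB_nonempty x).choose

/-- Probability that the play is absorbed within the first `N` stages; since absorbing
states are trapping this is the probability that the state of stage `N` is absorbing,
i.e. `P(ρ ≤ N)` where `ρ` is the absorption time. -/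
def absorbedProb (x₁ : G.X) (σ : G.toStocGame.Strategy1) (τ : G.toStocGame.Strategy2)
    (N : ℕ) : ℝ :=
  ∑' hx : List (G.X × G.A × G.B) × G.X,
    if hx.1.length + 1 = N ∧ G.absorbing hx.2 then
      G.toStocGame.histProb x₁ σ τ hx.1 hx.2 else 0

/-- A uniformly terminating strategy of player 1. -/
def UniformlyTerminating1 (σ : G.toStocGame.Strategy1) : Prop :=
  ∀ ε > (0 : ℝ), ∃ N : ℕ, 1 ≤ N ∧ ∀ x₁, ¬ G.absorbing x₁ →
    ∀ τ, G.absorbedProb x₁ σ τ N ≥ 1 - ε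

end RecGame

namespace StocGame

variable {G : StocGame}

/-- The expectation of `f` at the next state. -/
def nextExp (G : StocGame) (x : G.X) (a : G.A) (b : G.B) (f : G.X → ℝ) : ℝ :=
  ∑ y ∈ (G.q_finsupp x a b).toFinset, G.q x a b y * f y

theorem nextExp_eq_tsum (x : G.X) (a : G.A) (b : G.B) (f : G.X → ℝ) :
    G.nextExp x a b f = ∑' y, G.q x a b y * f y := by
  refine (tsum_eq_sum fun y hy => ?_).symm
  simp only [Set.Finite.mem_toFinset, Function.mem_support, not_not] at hy
  simp [hy]

theorem sum_q_eq_one (x : G.X) (a : G.A) (b : G.B) :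
    ∑ y ∈ (G.q_finsupp x a b).toFinset, G.q x a b y = 1 := by
  simpa only [nextExp, mul_one, G.q_sum] using G.nextExp_eq_tsum x a b fun _ => 1

theorem nextExp_const (x : G.X) (a : G.A) (b : G.B) (c : ℝ) :
    G.nextExp x a b (fun _ => c) = c := by
  rw [nextExp, ← Finset.sum_mul, sum_q_eq_one, one_mul]

theorem nextExp_mono {x : G.X} {a : G.A} {b : G.B} {f f' : G.X → ℝ}
    (h : ∀ y ∈ (G.q_finsupp x a b).toFinset, f y ≤ f' y) :
    G.nextExp x a b f ≤ G.nextExp x a b f' :=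
  Finset.sum_le_sum fun y hy => mul_le_mul_of_nonneg_left (h y hy) (G.q_nonneg x a b y)

theorem nextExp_add (x : G.X) (a : G.A) (b : G.B) (f f' : G.X → ℝ) :
    G.nextExp x a b (fun y => f y + f' y) = G.nextExp x a b f + G.nextExp x a b f' := by
  simp [nextExp, mul_add, Finset.sum_add_distrib]

theorem nextExp_const_mul (x : G.X) (a : G.A) (b : G.B) (c : ℝ) (f : G.X → ℝ) :
    G.nextExp x a b (fun y => c * f y) = c * G.nextExp x a b f := by
  simp only [nextExp, Finset.mul_sum]
  exact Finset.sum_congr rfl fun y _ => by ring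

theorem nextExp_finsetSum {ι : Type*} (s : Finset ι) (x : G.X) (a : G.A) (b : G.B)
    (f : ι → G.X → ℝ) :
    G.nextExp x a b (fun y => ∑ i ∈ s, f i y) = ∑ i ∈ s, G.nextExp x a b (f i) := by
  simp only [nextExp, Finset.mul_sum]
  exact Finset.sum_comm

theorem abs_nextExp_le {x : G.X} {a : G.A} {b : G.B} {f : G.X → ℝ} {c : ℝ}
    (h : ∀ y, |f y| ≤ c) : |G.nextExp x a b f| ≤ c := by
  rw [abs_le]
  constructor
  · rw [← G.nextExp_const x a b (-c)]
    exact nextExp_mono fun y _ => (abs_le.1 (h y)).1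
  · rw [← G.nextExp_const x a b c]
    exact nextExp_mono fun y _ => (abs_le.1 (h y)).2

/-- The continuation of a strategy after the first triple `e` of a history. -/
def Strategy1.shift (σ : Strategy1 G) (e : G.X × G.A × G.B) : Strategy1 G where
  play h := σ.play (e :: h)
  nonneg h := σ.nonneg (e :: h)
  supp h := σ.supp (e :: h)
  sum_one h := σ.sum_one (e :: h)

/-- The continuation of a strategy after the first triple `e` of a history. -/
def Strategy2.shift (τ : Strategy2 G) (e : G.X × G.A × G.B) : Strategy2 G where
  play h := τ.play (e :: h)
  nonneg h := τ.nonneg (e :: h)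
  supp h := τ.supp (e :: h)
  sum_one h := τ.sum_one (e :: h)

instance : Nonempty (Strategy1 G) :=
  ⟨{ play := fun _ x a => if a = (G.actA_nonempty x).choose then 1 else 0
     nonneg := fun _ _ _ => by positivity
     supp := fun _ x a ha => if_neg fun h : a = _ =>
       ha (h ▸ (G.actA_nonempty x).choose_spec)
     sum_one := fun _ x => by simp [(G.actA_nonempty x).choose_spec] }⟩

instance : Nonempty (Strategy2 G) :=
  ⟨{ play := fun _ x b => if b = (G.actB_nonempty x).choose then 1 else 0
     nonneg := fun _ _ _ => by positivity
     supp := fun _ x b hb => if_neg fun h : b = _ =>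
       hb (h ▸ (G.actB_nonempty x).choose_spec)
     sum_one := fun _ x => by simp [(G.actB_nonempty x).choose_spec] }⟩

theorem histProbAux_append (x₁ : G.X) (σ : Strategy1 G) (τ : Strategy2 G) (y : G.X) (a : G.A)
    (b : G.B) (l : List (G.X × G.A × G.B)) (x : G.X) :
    G.histProbAux x₁ σ τ (l ++ [(y, a, b)]) x =
      if y = x₁ then σ.play [] y a * τ.play [] y b *
        G.nextExp y a b fun z =>
          G.histProbAux z (σ.shift (y, a, b)) (τ.shift (y, a, b)) l x
      else 0 := by
  induction l generalizing x with
  | nil =>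
    split_ifs with h
    · simp only [List.nil_append, histProbAux, List.reverse_nil, h, if_true, one_mul,
        nextExp_eq_tsum, mul_ite, mul_one, mul_zero]
      rw [tsum_eq_single x fun z hz => if_neg hz.symm, if_pos rfl]
    · simp [histProbAux, h]
  | cons e l ih =>
    obtain ⟨y', a', b'⟩ := e
    simp only [List.cons_append, histProbAux, ih]
    split_ifs with h
    · simp only [nextExp, Finset.mul_sum, Finset.sum_mul, List.reverse_append,
        List.reverse_cons, List.reverse_nil, List.nil_append, List.cons_append,
        Strategy1.shift, Strategy2.shift]
      exact Finset.sum_congr rfl fun z _ => by ring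
    · simp

theorem histProb_cons (x₁ : G.X) (σ : Strategy1 G) (τ : Strategy2 G) (y : G.X) (a : G.A)
    (b : G.B) (h : List (G.X × G.A × G.B)) (x : G.X) :
    G.histProb x₁ σ τ ((y, a, b) :: h) x =
      if y = x₁ then σ.play [] y a * τ.play [] y b *
        G.nextExp y a b fun z =>
          G.histProb z (σ.shift (y, a, b)) (τ.shift (y, a, b)) h x
      else 0 := by
  simp only [histProb, List.reverse_cons, histProbAux_append]

/-- The contribution of a finite history to the payoff of stage `t`. -/
def stageTerm (x₁ : G.X) (σ : Strategy1 G) (τ : Strategy2 G) (t : ℕ)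
    (hx : List (G.X × G.A × G.B) × G.X) : ℝ :=
  if hx.1.length + 1 = t then
    G.histProb x₁ σ τ hx.1 hx.2 *
      ∑ a ∈ G.actA hx.2, ∑ b ∈ G.actB hx.2,
        σ.play hx.1 hx.2 a * τ.play hx.1 hx.2 b * G.g hx.2 a b
  else 0

/-- The expectation of `f` under the mixed actions chosen at the first stage. -/
def firstExp (x₁ : G.X) (σ : Strategy1 G) (τ : Strategy2 G) (f : G.A → G.B → ℝ) : ℝ :=
  ∑ a ∈ G.actA x₁, ∑ b ∈ G.actB x₁, σ.play [] x₁ a * τ.play [] x₁ b * f a b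

theorem firstExp_add (x₁ : G.X) (σ : Strategy1 G) (τ : Strategy2 G) (f f' : G.A → G.B → ℝ) :
    firstExp x₁ σ τ (fun a b => f a b + f' a b) = firstExp x₁ σ τ f + firstExp x₁ σ τ f' := by
  simp [firstExp, mul_add, Finset.sum_add_distrib]

theorem firstExp_finsetSum {ι : Type*} (s : Finset ι) (x₁ : G.X) (σ : Strategy1 G)
    (τ : Strategy2 G) (f : ι → G.A → G.B → ℝ) :
    firstExp x₁ σ τ (fun a b => ∑ i ∈ s, f i a b) = ∑ i ∈ s, firstExp x₁ σ τ (f i) := by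
  simp only [firstExp, Finset.mul_sum]
  rw [Finset.sum_comm]
  simp_rw [Finset.sum_comm (s := G.actA x₁)]
  rw [Finset.sum_comm]

theorem abs_firstExp_le {x₁ : G.X} {σ : Strategy1 G} {τ : Strategy2 G} {f : G.A → G.B → ℝ}
    {c : ℝ} (h : ∀ a b, |f a b| ≤ c) : |firstExp x₁ σ τ f| ≤ c := by
  calc |firstExp x₁ σ τ f|
      ≤ ∑ a ∈ G.actA x₁, ∑ b ∈ G.actB x₁, σ.play [] x₁ a * τ.play [] x₁ b * c := by
        refine (Finset.abs_sum_le_sum_abs _ _).trans (Finset.sum_le_sum fun a _ => ?_)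
        refine (Finset.abs_sum_le_sum_abs _ _).trans (Finset.sum_le_sum fun b _ => ?_)
        have hp := mul_nonneg (σ.nonneg [] x₁ a) (τ.nonneg [] x₁ b)
        rw [abs_mul, abs_of_nonneg hp]
        exact mul_le_mul_of_nonneg_left (h a b) hp
    _ = c := by
        simp_rw [← Finset.sum_mul, ← Finset.mul_sum, τ.sum_one, mul_one, σ.sum_one, one_mul]

/-- Extension by zero of a function on histories along prepending the triple `e`. -/
def consExtend (e : G.X × G.A × G.B) (f : List (G.X × G.A × G.B) × G.X → ℝ) :
    List (G.X × G.A × G.B) × G.X → ℝ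
  | ([], _) => 0
  | (e' :: h, x) => if e' = e then f (h, x) else 0

theorem hasSum_consExtend {e : G.X × G.A × G.B} {f : List (G.X × G.A × G.B) × G.X → ℝ} {s : ℝ}
    (hf : HasSum f s) : HasSum (consExtend e f) s := by
  have hinj : Function.Injective
      fun hx : List (G.X × G.A × G.B) × G.X => (e :: hx.1, hx.2) := by
    rintro ⟨h, x⟩ ⟨h', x'⟩ heq
    simpa using heq
  rw [← hinj.hasSum_iff]
  · simpa [Function.comp_def, consExtend] using hf
  · rintro ⟨_ | ⟨e', h⟩, x⟩ hx
    · rfl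
    · refine if_neg ?_
      rintro rfl
      exact hx ⟨(h, x), rfl⟩

theorem stageTerm_add_two (x₁ : G.X) (σ : Strategy1 G) (τ : Strategy2 G) (t : ℕ)
    (hx : List (G.X × G.A × G.B) × G.X) :
    stageTerm x₁ σ τ (t + 2) hx =
      firstExp x₁ σ τ fun a b => G.nextExp x₁ a b fun z =>
        consExtend (x₁, a, b)
          (stageTerm z (σ.shift (x₁, a, b)) (τ.shift (x₁, a, b)) (t + 1)) hx := by
  obtain ⟨_ | ⟨⟨y, a', b'⟩, h⟩, x⟩ := hx
  · simp [stageTerm, consExtend, firstExp, nextExp]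
  · by_cases hy : y = x₁
    · subst hy
      have key : firstExp y σ τ (fun a b => G.nextExp y a b fun z =>
          consExtend (y, a, b)
            (stageTerm z (σ.shift (y, a, b)) (τ.shift (y, a, b)) (t + 1))
              ((y, a', b') :: h, x)) =
          σ.play [] y a' * τ.play [] y b' * G.nextExp y a' b' fun z =>
            stageTerm z (σ.shift (y, a', b')) (τ.shift (y, a', b')) (t + 1) (h, x) := by
        rw [firstExp, Finset.sum_eq_single a', Finset.sum_eq_single b']
        · simp [consExtend]
        · intro b _ hb
          simp [consExtend, hb.symm, nextExp]
        · intro hb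
          simp [τ.supp [] y b' hb]
        · intro a _ ha
          simp [consExtend, ha.symm, nextExp]
        · intro ha
          simp [σ.supp [] y a' ha]
      rw [key]
      simp only [stageTerm, List.length_cons, histProb_cons, if_true]
      by_cases hl : h.length = t
      · simp only [hl, if_true]
        rw [mul_assoc, nextExp, nextExp, Finset.sum_mul]
        simp only [mul_assoc]
        rfl
      · simp [hl, nextExp]
    · simp [stageTerm, consExtend, firstExp, nextExp, histProb_cons, hy]

theorem hasSum_stageTerm_add_two {x₁ : G.X} {σ : Strategy1 G} {τ : Strategy2 G} {t : ℕ}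
    {s : G.A → G.B → G.X → ℝ}
    (hs : ∀ a b z, HasSum
      (stageTerm z (σ.shift (x₁, a, b)) (τ.shift (x₁, a, b)) (t + 1)) (s a b z)) :
    HasSum (stageTerm x₁ σ τ (t + 2)) (firstExp x₁ σ τ fun a b => G.nextExp x₁ a b (s a b)) := by
  rw [funext (stageTerm_add_two x₁ σ τ t)]
  exact hasSum_sum fun a _ => hasSum_sum fun b _ => (hasSum_sum fun z _ =>
    (hasSum_consExtend (hs a b z)).mul_left _).mul_left _

theorem hasSum_stageTerm_one (x₁ : G.X) (σ : Strategy1 G) (τ : Strategy2 G) :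
    HasSum (stageTerm x₁ σ τ 1) (firstExp x₁ σ τ (G.g x₁)) := by
  have h : stageTerm x₁ σ τ 1 ([], x₁) = firstExp x₁ σ τ (G.g x₁) := by
    simp [stageTerm, histProb, histProbAux, firstExp]
  rw [← h]
  refine hasSum_single _ ?_
  rintro ⟨_ | ⟨e, h⟩, x⟩ hx
  · have : x ≠ x₁ := fun hxx => hx (by rw [hxx])
    simp [stageTerm, histProb, histProbAux, this]
  · simp [stageTerm]

theorem hasSum_stageTerm (x₁ : G.X) (σ : Strategy1 G) (τ : Strategy2 G) (t : ℕ) :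
    HasSum (stageTerm x₁ σ τ (t + 1)) (G.stagePayoff x₁ σ τ (t + 1)) := by
  refine Summable.hasSum ?_
  induction t generalizing x₁ σ τ with
  | zero => exact (hasSum_stageTerm_one x₁ σ τ).summable
  | succ t ih =>
    exact (hasSum_stageTerm_add_two fun a b z => (ih z _ _).hasSum).summable

theorem stagePayoff_one (x₁ : G.X) (σ : Strategy1 G) (τ : Strategy2 G) :
    G.stagePayoff x₁ σ τ 1 = firstExp x₁ σ τ (G.g x₁) :=
  (hasSum_stageTerm_one x₁ σ τ).tsum_eq

theorem stagePayoff_add_two (x₁ : G.X) (σ : Strategy1 G) (τ : Strategy2 G) (t : ℕ) :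
    G.stagePayoff x₁ σ τ (t + 2) =
      firstExp x₁ σ τ fun a b => G.nextExp x₁ a b fun z =>
        G.stagePayoff z (σ.shift (x₁, a, b)) (τ.shift (x₁, a, b)) (t + 1) :=
  (hasSum_stageTerm_add_two fun _ _ z => hasSum_stageTerm z _ _ t).tsum_eq

theorem abs_stagePayoff_le (x₁ : G.X) (σ : Strategy1 G) (τ : Strategy2 G) (t : ℕ) :
    |G.stagePayoff x₁ σ τ (t + 1)| ≤ 1 := by
  induction t generalizing x₁ σ τ with
  | zero =>
    rw [stagePayoff_one]
    exact abs_firstExp_le (G.g_bdd x₁)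
  | succ t ih =>
    rw [stagePayoff_add_two]
    exact abs_firstExp_le fun a b => abs_nextExp_le fun z => ih z _ _

theorem avgPayoff_eq_sum_range (x₁ : G.X) (σ : Strategy1 G) (τ : Strategy2 G) (n : ℕ) :
    G.avgPayoff x₁ σ τ n = (n : ℝ)⁻¹ * ∑ t ∈ Finset.range n, G.stagePayoff x₁ σ τ (t + 1) := by
  rw [avgPayoff, Finset.range_eq_Ico, Finset.sum_Ico_add' (G.stagePayoff x₁ σ τ) 0 n 1]
  rfl

theorem abs_avgPayoff_le (x₁ : G.X) (σ : Strategy1 G) (τ : Strategy2 G) (n : ℕ) :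
    |G.avgPayoff x₁ σ τ n| ≤ 1 := by
  rw [avgPayoff_eq_sum_range, abs_mul, abs_of_nonneg (by positivity)]
  have h : |∑ t ∈ Finset.range n, G.stagePayoff x₁ σ τ (t + 1)| ≤ n := by
    refine (Finset.abs_sum_le_sum_abs _ _).trans ?_
    simpa using Finset.sum_le_card_nsmul (Finset.range n) _ 1
      fun t _ => abs_stagePayoff_le x₁ σ τ t
  exact (mul_le_mul_of_nonneg_left h (by positivity)).trans inv_mul_le_one

/-- The recursive formula for the payoff of the `(n + 1)`-stage game. -/
theorem avgPayoff_succ (x₁ : G.X) (σ : Strategy1 G) (τ : Strategy2 G) (n : ℕ) :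
    (n + 1 : ℝ) * G.avgPayoff x₁ σ τ (n + 1) =
      firstExp x₁ σ τ fun a b => G.g x₁ a b + n * G.nextExp x₁ a b fun z =>
        G.avgPayoff z (σ.shift (x₁, a, b)) (τ.shift (x₁, a, b)) n := by
  have hn : (n + 1 : ℝ) ≠ 0 := by positivity
  rw [avgPayoff_eq_sum_range, Nat.cast_succ, mul_inv_cancel_left₀ hn, Finset.sum_range_succ',
    add_comm, firstExp_add, zero_add, stagePayoff_one]
  simp_rw [stagePayoff_add_two, ← firstExp_finsetSum, ← nextExp_finsetSum, ← nextExp_const_mul,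
    avgPayoff_eq_sum_range]
  rcases eq_or_ne n 0 with rfl | h0
  · simp
  · have h0' : (n : ℝ) ≠ 0 := by exact_mod_cast h0
    simp_rw [mul_inv_cancel_left₀ h0']

/-- Two strategies of player 2 which coincide on the histories starting at `x₁` induce the same
payoff from `x₁`. -/
theorem avgPayoff_congr_right {x₁ : G.X} (σ : Strategy1 G) {τ τ' : Strategy2 G}
    (h_nil : τ.play [] x₁ = τ'.play [] x₁)
    (h_cons : ∀ a b h, τ.play ((x₁, a, b) :: h) = τ'.play ((x₁, a, b) :: h)) (n : ℕ) :
    G.avgPayoff x₁ σ τ n = G.avgPayoff x₁ σ τ' n := by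
  rcases n with _ | n
  · simp [avgPayoff]
  · have hs : ∀ a b, τ.shift (x₁, a, b) = τ'.shift (x₁, a, b) := fun a b => by
      simp only [Strategy2.shift, Strategy2.mk.injEq]
      exact funext (h_cons a b)
    refine mul_left_cancel₀ (a := (n + 1 : ℝ))
      (by positivity) ?_
    simp only [avgPayoff_succ, firstExp, h_nil, hs]

theorem bddBelow_avgPayoff (x₁ : G.X) (σ : Strategy1 G) (n : ℕ) :
    BddBelow (Set.range fun τ => G.avgPayoff x₁ σ τ n) :=
  ⟨-1, by rintro _ ⟨τ, rfl⟩; exact (abs_le.1 (abs_avgPayoff_le x₁ σ τ n)).1⟩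

theorem abs_iInf_avgPayoff_le (x₁ : G.X) (σ : Strategy1 G) (n : ℕ) :
    |⨅ τ, G.avgPayoff x₁ σ τ n| ≤ 1 := by
  refine abs_le.2 ⟨le_ciInf fun τ => (abs_le.1 (abs_avgPayoff_le x₁ σ τ n)).1, ?_⟩
  obtain ⟨τ⟩ : Nonempty (Strategy2 G) := inferInstance
  exact (ciInf_le (bddBelow_avgPayoff x₁ σ n) τ).trans
    (abs_le.1 (abs_avgPayoff_le x₁ σ τ n)).2

theorem iInf_avgPayoff_le_nValue (x₁ : G.X) (σ : Strategy1 G) (n : ℕ) :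
    ⨅ τ, G.avgPayoff x₁ σ τ n ≤ G.nValue n x₁ :=
  le_ciSup (f := fun σ => ⨅ τ, G.avgPayoff x₁ σ τ n)
    ⟨1, by rintro _ ⟨σ, rfl⟩; exact (abs_le.1 (abs_iInf_avgPayoff_le x₁ σ n)).2⟩ σ

theorem abs_nValue_le (n : ℕ) (x₁ : G.X) : |G.nValue n x₁| ≤ 1 := by
  obtain ⟨σ⟩ : Nonempty (Strategy1 G) := inferInstance
  exact abs_le.2 ⟨(abs_le.1 (abs_iInf_avgPayoff_le x₁ σ n)).1.trans
    (iInf_avgPayoff_le_nValue x₁ σ n),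
    ciSup_le fun σ => (abs_le.1 (abs_iInf_avgPayoff_le x₁ σ n)).2⟩

/-- The strategy of player 2 which plays `b` at the initial state `x₁`, and after the first triple
`e` and the second state `z` follows `T e z`. -/
def Strategy2.glue (x₁ : G.X) (b : G.B) (hb : b ∈ G.actB x₁)
    (T : G.X × G.A × G.B → G.X → Strategy2 G) : Strategy2 G where
  play
    | [], x, b' => if b' = (if x = x₁ then b else (G.actB_nonempty x).choose) then 1 else 0
    | [e], x, b' => (T e x).play [] x b'
    | e :: e' :: h, x, b' => (T e e'.1).play (e' :: h) x b'
  nonneg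
    | [], _, _ => by positivity
    | [e], x, b' => (T e x).nonneg [] x b'
    | e :: e' :: h, x, b' => (T e e'.1).nonneg (e' :: h) x b'
  supp
    | [], x, b', hb' => by
      refine if_neg ?_
      rintro rfl
      split_ifs at hb' with h
      · exact hb' (h ▸ hb)
      · exact hb' (G.actB_nonempty x).choose_spec
    | [e], x, b', hb' => (T e x).supp [] x b' hb'
    | e :: e' :: h, x, b', hb' => (T e e'.1).supp (e' :: h) x b' hb'
  sum_one
    | [], x => by
      rw [Finset.sum_ite_eq', if_pos]
      split_ifs with h
      · exact h ▸ hb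
      · exact (G.actB_nonempty x).choose_spec
    | [e], x => (T e x).sum_one [] x
    | e :: e' :: h, x => (T e e'.1).sum_one (e' :: h) x

theorem firstExp_glue (x₁ : G.X) (σ : Strategy1 G) (b : G.B) (hb : b ∈ G.actB x₁)
    (T : G.X × G.A × G.B → G.X → Strategy2 G) (f : G.A → G.B → ℝ) :
    firstExp x₁ σ (Strategy2.glue x₁ b hb T) f = ∑ a ∈ G.actA x₁, σ.play [] x₁ a * f a b := by
  refine Finset.sum_congr rfl fun a _ => ?_
  simp [Strategy2.glue, hb]

theorem avgPayoff_glue_shift (x₁ : G.X) (b : G.B) (hb : b ∈ G.actB x₁)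
    (T : G.X × G.A × G.B → G.X → Strategy2 G) (e : G.X × G.A × G.B) (z : G.X)
    (σ : Strategy1 G) (n : ℕ) :
    G.avgPayoff z σ ((Strategy2.glue x₁ b hb T).shift e) n = G.avgPayoff z σ (T e z) n :=
  avgPayoff_congr_right (τ := (Strategy2.glue x₁ b hb T).shift e) (τ' := T e z) σ rfl
    (fun _ _ _ => rfl) n

/-- One half of the Shapley equation, for the maxmin and up to `ε`. -/
theorem exists_mixed_action_nValue_succ_le (x₁ : G.X) (n : ℕ) {ε : ℝ} (hε : 0 < ε) :
    ∃ σ : Strategy1 G, ∀ b ∈ G.actB x₁,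
      (n + 1 : ℝ) * (G.nValue (n + 1) x₁ - ε) ≤
        ∑ a ∈ G.actA x₁, σ.play [] x₁ a *
          (G.g x₁ a b + n * (G.nextExp x₁ a b (G.nValue n) + ε)) := by
  obtain ⟨σ, hσ⟩ := exists_lt_of_lt_ciSup (sub_lt_self (G.nValue (n + 1) x₁) hε)
  refine ⟨σ, fun b hb => ?_⟩
  have hT : ∀ (e : G.X × G.A × G.B) (z : G.X), ∃ τ,
      G.avgPayoff z (σ.shift e) τ n < G.nValue n z + ε := fun e z =>
    exists_lt_of_ciInf_lt ((iInf_avgPayoff_le_nValue z (σ.shift e) n).trans_lt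
      (lt_add_of_pos_right _ hε))
  choose T hT using hT
  calc (n + 1 : ℝ) * (G.nValue (n + 1) x₁ - ε)
      ≤ (n + 1 : ℝ) * G.avgPayoff x₁ σ (Strategy2.glue x₁ b hb T) (n + 1) :=
        mul_le_mul_of_nonneg_left
          (hσ.le.trans (ciInf_le (bddBelow_avgPayoff x₁ σ (n + 1)) _)) (by positivity)
    _ ≤ _ := by
        rw [avgPayoff_succ, firstExp_glue]
        refine Finset.sum_le_sum fun a _ => mul_le_mul_of_nonneg_left ?_ (σ.nonneg [] x₁ a)
        simp_rw [avgPayoff_glue_shift]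
        gcongr
        calc _ ≤ G.nextExp x₁ a b fun z => G.nValue n z + ε := nextExp_mono fun z _ => (hT _ z).le
          _ = _ := by rw [nextExp_add, nextExp_const]

theorem exists_mixed_action_limsupV_sub_le (x₁ : G.X) {ε : ℝ} (hε : 0 < ε) :
    ∃ σ : Strategy1 G, ∀ b ∈ G.actB x₁,
      G.limsupV x₁ - ε ≤ ∑ a ∈ G.actA x₁, σ.play [] x₁ a * G.nextExp x₁ a b G.limsupV := by
  obtain ⟨δ, hδ, hδε⟩ : ∃ δ > 0, 8 * δ ≤ ε := ⟨ε / 8, by positivity, by linarith⟩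
  have hev : ∀ᶠ n : ℕ in atTop, ∀ a ∈ G.actA x₁, ∀ b ∈ G.actB x₁,
      ∀ z ∈ (G.q_finsupp x₁ a b).toFinset, G.nValue n z ≤ G.limsupV z + δ := by
    simp only [Filter.eventually_all_finset]
    intro a _ b _ z _
    refine (eventually_lt_of_limsup_lt (lt_add_of_pos_right (G.limsupV z) hδ) ?_).mono
      fun n hn => hn.le
    exact isBoundedUnder_of ⟨1, fun n => (abs_le.1 (abs_nValue_le n z)).2⟩
  have hlarge : ∀ᶠ n : ℕ in atTop, 2 ≤ δ * n := by
    filter_upwards [tendsto_natCast_atTop_atTop.eventually_ge_atTop (2 / δ)] with n hn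
    rwa [div_le_iff₀' hδ] at hn
  have hfreq : ∃ᶠ n : ℕ in atTop, G.limsupV x₁ - δ < G.nValue n x₁ := by
    refine frequently_lt_of_lt_limsup ?_ (sub_lt_self _ hδ)
    exact IsBoundedUnder.isCoboundedUnder_le
      (isBoundedUnder_of ⟨-1, fun n => (abs_le.1 (abs_nValue_le n x₁)).1⟩)
  rw [← map_add_atTop_eq_nat 1, frequently_map] at hfreq
  obtain ⟨n, hn, hz, hN, hn1⟩ :=
    (hfreq.and_eventually (hev.and (hlarge.and (eventually_ge_atTop 1)))).exists
  obtain ⟨σ, hσ⟩ := exists_mixed_action_nValue_succ_le x₁ n hδ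
  refine ⟨σ, fun b hb => ?_⟩
  have hv : -1 ≤ G.limsupV x₁ :=
    le_limsup_of_frequently_le
      (Frequently.of_forall fun n => (abs_le.1 (abs_nValue_le n x₁)).1)
      (isBoundedUnder_of ⟨1, fun n => (abs_le.1 (abs_nValue_le n x₁)).2⟩)
  have hsum := σ.sum_one [] x₁
  have hn1' : (1 : ℝ) ≤ n := by exact_mod_cast hn1
  set E := ∑ a ∈ G.actA x₁, σ.play [] x₁ a * G.nextExp x₁ a b G.limsupV with hE
  have hupper : ∑ a ∈ G.actA x₁, σ.play [] x₁ a *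
      (G.g x₁ a b + n * (G.nextExp x₁ a b (G.nValue n) + δ)) ≤ 1 + n * (E + 2 * δ) := by
    calc _ ≤ ∑ a ∈ G.actA x₁, σ.play [] x₁ a *
          (1 + n * (G.nextExp x₁ a b G.limsupV + 2 * δ)) := by
          refine Finset.sum_le_sum fun a ha =>
            mul_le_mul_of_nonneg_left ?_ (σ.nonneg [] x₁ a)
          have h1 := (abs_le.1 (G.g_bdd x₁ a b)).2
          have h2 : G.nextExp x₁ a b (G.nValue n) ≤ G.nextExp x₁ a b G.limsupV + δ := by
            calc _ ≤ G.nextExp x₁ a b fun z => G.limsupV z + δ := nextExp_mono (hz a ha b hb)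
              _ = _ := by rw [nextExp_add, nextExp_const]
          have h3 : G.nextExp x₁ a b (G.nValue n) + δ ≤
            G.nextExp x₁ a b G.limsupV + 2 * δ := by linarith
          gcongr
      _ = (∑ a ∈ G.actA x₁, σ.play [] x₁ a) * (1 + n * (2 * δ)) + n * E := by
          rw [hE, Finset.sum_mul, Finset.mul_sum, ← Finset.sum_add_distrib]
          exact Finset.sum_congr rfl fun a _ => by ring
      _ = _ := by rw [hsum]; ring
  have hmain := (hσ b hb).trans hupper
  by_contra! hlt
  have h1 : (n + 1 : ℝ) * (G.limsupV x₁ - 2 * δ) ≤ (n + 1) * (G.nValue (n + 1) x₁ - δ) :=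
    mul_le_mul_of_nonneg_left (by linarith) (by positivity)
  have h2 : (n : ℝ) * E ≤ n * (G.limsupV x₁ - 8 * δ) :=
    mul_le_mul_of_nonneg_left (by linarith) (by positivity)
  nlinarith [mul_le_mul_of_nonneg_left hn1' hδ.le]

end StocGame

/-- Let `Γ` be a recursive game (countable state space) with
`{v_n : n ≥ 1}` totally bounded for the uniform norm and let `v = limsup_n v_n`.
Then for every state `x₁` there is a mixed action `s*(x₁)` on `A(x₁)` such that for
every `b ∈ B(x₁)`, `E_{q(x₁, s*(x₁), b)}[v(x₂)] ≥ v(x₁)`. -/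
theorem exists_mixed_action_submartingale
    (G : RecGame) (hcount : Countable G.X)
    (htb : G.toStocGame.TotallyBoundedValues) :
    ∀ x₁ : G.X, ∃ s : G.A → ℝ,
      (∀ a, 0 ≤ s a) ∧ (∀ a ∉ G.actA x₁, s a = 0) ∧ (∑ a ∈ G.actA x₁, s a = 1) ∧
      ∀ b ∈ G.actB x₁,
        (∑ a ∈ G.actA x₁, s a * ∑' y, G.q x₁ a b y * G.toStocGame.limsupV y) ≥
          G.toStocGame.limsupV x₁ := by
  intro x₁
  have hB := G.actB_nonempty x₁
  let F : (G.actA x₁ → ℝ) → ℝ := fun s => (G.actB x₁).inf' hB fun b =>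
    ∑ a, s a * ∑' y, G.q x₁ a b y * G.toStocGame.limsupV y
  have hF : Continuous F := Continuous.finset_inf'_apply hB fun b _ => by fun_prop
  have happrox : ∀ ε > (0 : ℝ), ∃ s ∈ stdSimplex ℝ (G.actA x₁),
      G.toStocGame.limsupV x₁ - ε ≤ F s := by
    intro ε hε
    obtain ⟨σ, hσ⟩ := StocGame.exists_mixed_action_limsupV_sub_le (G := G.toStocGame) x₁ hε
    refine ⟨fun a => σ.play [] x₁ a, ⟨fun a => σ.nonneg [] x₁ a, ?_⟩,
      Finset.le_inf' _ _ fun b hb => ?_⟩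
    · rw [← σ.sum_one [] x₁]
      exact Finset.sum_coe_sort (G.actA x₁) (σ.play [] x₁)
    · rw [Finset.sum_coe_sort (G.actA x₁) fun a =>
        σ.play [] x₁ a * ∑' y, G.q x₁ a b y * G.toStocGame.limsupV y]
      simpa only [StocGame.nextExp_eq_tsum] using hσ b hb
  obtain ⟨s₀, hs₀, -⟩ := happrox 1 one_pos
  obtain ⟨s, ⟨hs_nonneg, hs_sum⟩, hmax⟩ :=
    (isCompact_stdSimplex ℝ (G.actA x₁)).exists_isMaxOn ⟨s₀, hs₀⟩ hF.continuousOn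
  have hs : G.toStocGame.limsupV x₁ ≤ F s := by
    refine le_of_forall_sub_le fun ε hε => ?_
    obtain ⟨s', hs', hle⟩ := happrox ε hε
    exact hle.trans (hmax hs')
  refine ⟨fun a => if ha : a ∈ G.actA x₁ then s ⟨a, ha⟩ else 0, fun a => ?_,
    fun a ha => dif_neg ha, ?_, fun b hb => ?_⟩
  · dsimp only
    split_ifs with ha
    · exact hs_nonneg _
    · exact le_rfl
  · rw [← hs_sum, ← Finset.sum_coe_sort]
    simp
  · refine (hs.trans (Finset.inf'_le _ hb)).trans_eq ?_
    rw [← Finset.sum_coe_sort (G.actA x₁)]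
    simp
end
end

section
/- Let Γ be a recursive game, so that the stage payoff depends only on the current state: g(x) = 0 for x ∈ X⁰ and g(x) equals the absorbing payoff for x ∈ X*. Fix an initial state x₁ ∈ X⁰ and a strategy σ ∈ Σ̂ of player 1 depending only on the sequence of states. Then for every n ≥ 1 there exists a (pure) stopping time θ : ∪_{1≤t≤n} X^t → {1,…,n}, depending only on the sequence of states, such that for every strategy τ ∈ 𝒯 of player 2: E_{x₁,σ,τ}[g(x_θ)] ≥ min_{τ' ∈ 𝒯} E_{x₁,σ,τ'}[(1/n) Σ_{t=1}^n g(x_t)]. -/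
open scoped Classical
open Filter

noncomputable section

namespace StocGame

variable (G : StocGame)

/-- A finite set containing every state reachable in one step from `x`. -/
def successors (x : G.X) : Finset G.X :=
  (G.actA x).biUnion fun a => (G.actB x).biUnion fun b => (G.q_finsupp x a b).toFinset

variable {G} in
lemma mem_successors {x y : G.X} {a : G.A} {b : G.B} (ha : a ∈ G.actA x) (hb : b ∈ G.actB x)
    (hy : G.q x a b y ≠ 0) : y ∈ G.successors x := by
  simp only [successors, Finset.mem_biUnion, Set.Finite.mem_toFinset, Function.mem_support]
  exact ⟨a, ha, b, hb, hy⟩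

variable {G} in
lemma sum_successors_q {x : G.X} {a : G.A} {b : G.B} (ha : a ∈ G.actA x) (hb : b ∈ G.actB x) :
    ∑ y ∈ G.successors x, G.q x a b y = 1 := by
  rw [← G.q_sum x a b, tsum_eq_sum]
  intro y hy
  by_contra h
  exact hy (mem_successors ha hb h)

/-- The one-step extensions of a history with current state. -/
def extensions (hx : List (G.X × G.A × G.B) × G.X) :
    Finset (List (G.X × G.A × G.B) × G.X) :=
  (G.actA hx.2 ×ˢ G.actB hx.2 ×ˢ G.successors hx.2).image
    fun p => (hx.1 ++ [(hx.2, p.1, p.2.1)], p.2.2)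

/-- A finite set containing every history of length `t` (with its current state) which has
positive probability when the game starts at `x₁`. -/
def reachable (x₁ : G.X) : ℕ → Finset (List (G.X × G.A × G.B) × G.X)
  | 0 => {([], x₁)}
  | t + 1 => (reachable x₁ t).biUnion G.extensions

lemma length_of_mem_reachable {x₁ : G.X} {t : ℕ} {hx : List (G.X × G.A × G.B) × G.X}
    (h : hx ∈ G.reachable x₁ t) : hx.1.length = t := by
  induction t generalizing hx with
  | zero => simp only [reachable, Finset.mem_singleton] at h; simp [h]
  | succ t ih =>
    simp only [reachable, extensions, Finset.mem_biUnion, Finset.mem_image] at h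
    obtain ⟨hx', h', p, -, rfl⟩ := h
    simp [ih h']

variable (x₁ : G.X) (σ : Strategy1 G) (τ : Strategy2 G)

lemma histProb_nil (x : G.X) : G.histProb x₁ σ τ [] x = if x = x₁ then 1 else 0 := rfl

lemma histProb_concat (h : List (G.X × G.A × G.B)) (y : G.X) (a : G.A) (b : G.B) (x : G.X) :
    G.histProb x₁ σ τ (h ++ [(y, a, b)]) x =
      G.histProb x₁ σ τ h y * σ.play h y a * τ.play h y b * G.q y a b x := by
  simp [histProb, histProbAux]

lemma histProb_nonneg (h : List (G.X × G.A × G.B)) (x : G.X) : 0 ≤ G.histProb x₁ σ τ h x := by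
  induction h using List.reverseRecOn generalizing x with
  | nil => rw [histProb_nil]; split_ifs <;> norm_num
  | append_singleton h z ih =>
    obtain ⟨y, a, b⟩ := z
    rw [histProb_concat]
    exact mul_nonneg (mul_nonneg (mul_nonneg (ih y) (σ.nonneg _ _ _)) (τ.nonneg _ _ _))
      (G.q_nonneg _ _ _ _)

lemma mem_reachable_of_histProb_ne_zero {h : List (G.X × G.A × G.B)} {x : G.X}
    (hne : G.histProb x₁ σ τ h x ≠ 0) : (h, x) ∈ G.reachable x₁ h.length := by
  induction h using List.reverseRecOn generalizing x with
  | nil =>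
    rw [histProb_nil] at hne
    have : x = x₁ := by by_contra hx; simp [hx] at hne
    simp [reachable, this]
  | append_singleton h z ih =>
    obtain ⟨y, a, b⟩ := z
    rw [histProb_concat] at hne
    obtain ⟨⟨⟨h1, h2⟩, h3⟩, h4⟩ : ((_ ∧ _) ∧ _) ∧ _ := by
      simpa only [mul_ne_zero_iff] using hne
    have ha : a ∈ G.actA y := by by_contra hc; exact h2 (σ.supp _ _ _ hc)
    have hb : b ∈ G.actB y := by by_contra hc; exact h3 (τ.supp _ _ _ hc)
    rw [List.length_append, List.length_singleton, reachable, Finset.mem_biUnion]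
    refine ⟨(h, y), ih h1, Finset.mem_image.2 ⟨(a, b, x), ?_, rfl⟩⟩
    simpa [Finset.mem_product] using ⟨ha, hb, mem_successors ha hb h4⟩

/-- Expectation of a function of the history at stage `t + 1` (past history of length `t`). -/
def histExp (t : ℕ) (f : List (G.X × G.A × G.B) × G.X → ℝ) : ℝ :=
  ∑ hx ∈ G.reachable x₁ t, G.histProb x₁ σ τ hx.1 hx.2 * f hx

/-- Conditional expectation, given the current history, of a function of the next history. -/
def stepExp (f : List (G.X × G.A × G.B) × G.X → ℝ) (hx : List (G.X × G.A × G.B) × G.X) : ℝ :=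
  ∑ b ∈ G.actB hx.2, τ.play hx.1 hx.2 b * ∑ a ∈ G.actA hx.2, σ.play hx.1 hx.2 a *
    ∑ y ∈ G.successors hx.2, G.q hx.2 a b y * f (hx.1 ++ [(hx.2, a, b)], y)

lemma tsum_histProb_eq_histExp (t : ℕ) (f : List (G.X × G.A × G.B) × G.X → ℝ) :
    (∑' hx : List (G.X × G.A × G.B) × G.X,
      if hx.1.length + 1 = t + 1 then G.histProb x₁ σ τ hx.1 hx.2 * f hx else 0) =
      G.histExp x₁ σ τ t f := by
  rw [histExp, tsum_eq_sum (s := G.reachable x₁ t)]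
  · refine Finset.sum_congr rfl fun hx h => ?_
    rw [if_pos (by rw [G.length_of_mem_reachable h])]
  · intro hx h
    split_ifs with hl
    · have hp : G.histProb x₁ σ τ hx.1 hx.2 = 0 := by
        by_contra hne
        have := G.mem_reachable_of_histProb_ne_zero x₁ σ τ hne
        rw [Nat.succ_injective hl] at this
        exact h this
      rw [hp, zero_mul]
    · rfl

lemma histExp_zero (f : List (G.X × G.A × G.B) × G.X → ℝ) :
    G.histExp x₁ σ τ 0 f = f ([], x₁) := by
  simp [histExp, reachable, histProb_nil]

lemma histExp_succ (t : ℕ) (f : List (G.X × G.A × G.B) × G.X → ℝ) :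
    G.histExp x₁ σ τ (t + 1) f = G.histExp x₁ σ τ t (G.stepExp σ τ f) := by
  rw [histExp, reachable, Finset.sum_biUnion]
  · refine Finset.sum_congr rfl fun hx _ => ?_
    rw [extensions, Finset.sum_image]
    · rw [Finset.sum_product, stepExp, Finset.sum_congr rfl fun a _ => Finset.sum_product _ _ _,
        Finset.sum_comm, Finset.mul_sum]
      refine Finset.sum_congr rfl fun b _ => ?_
      rw [Finset.mul_sum, Finset.mul_sum]
      refine Finset.sum_congr rfl fun a _ => ?_
      rw [Finset.mul_sum, Finset.mul_sum, Finset.mul_sum]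
      refine Finset.sum_congr rfl fun y _ => ?_
      rw [histProb_concat]
      ring
    · rintro ⟨a, b, y⟩ - ⟨a', b', y'⟩ - h
      simpa [and_assoc] using h
  · intro hx _ hx' _ hne
    rw [Function.onFun, Finset.disjoint_left]
    intro z hz hz'
    simp only [extensions, Finset.mem_image] at hz hz'
    obtain ⟨p, -, rfl⟩ := hz
    obtain ⟨p', -, h⟩ := hz'
    apply hne
    simp only [Prod.mk.injEq] at h
    obtain ⟨h1, h2⟩ := List.append_inj' h.1 rfl
    simp only [List.cons.injEq, Prod.mk.injEq] at h2
    exact Prod.ext h1.symm h2.1.1.symm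

lemma histExp_mono {t : ℕ} {f f' : List (G.X × G.A × G.B) × G.X → ℝ}
    (h : ∀ hx, hx.1.length = t → f hx ≤ f' hx) :
    G.histExp x₁ σ τ t f ≤ G.histExp x₁ σ τ t f' :=
  Finset.sum_le_sum fun hx hm =>
    mul_le_mul_of_nonneg_left (h hx (G.length_of_mem_reachable hm)) (G.histProb_nonneg _ _ _ _ _)

lemma histExp_add (t : ℕ) (f f' : List (G.X × G.A × G.B) × G.X → ℝ) :
    G.histExp x₁ σ τ t (fun hx => f hx + f' hx) =
      G.histExp x₁ σ τ t f + G.histExp x₁ σ τ t f' := by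
  simp only [histExp, mul_add, Finset.sum_add_distrib]

lemma histExp_const_mul (t : ℕ) (c : ℝ) (f : List (G.X × G.A × G.B) × G.X → ℝ) :
    G.histExp x₁ σ τ t (fun hx => c * f hx) = c * G.histExp x₁ σ τ t f := by
  simp only [histExp, Finset.mul_sum]
  exact Finset.sum_congr rfl fun _ _ => by ring

lemma stepExp_eq_const {f : List (G.X × G.A × G.B) × G.X → ℝ} {c : ℝ}
    {hx : List (G.X × G.A × G.B) × G.X}
    (h : ∀ a b y, f (hx.1 ++ [(hx.2, a, b)], y) = c) : G.stepExp σ τ f hx = c := by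
  have key : ∀ b ∈ G.actB hx.2, (∑ a ∈ G.actA hx.2, σ.play hx.1 hx.2 a *
      ∑ y ∈ G.successors hx.2, G.q hx.2 a b y * f (hx.1 ++ [(hx.2, a, b)], y)) = c := by
    intro b hb
    rw [Finset.sum_congr rfl (g := fun a => σ.play hx.1 hx.2 a * c), ← Finset.sum_mul,
      σ.sum_one, one_mul]
    intro a ha
    simp only [h, ← Finset.sum_mul, sum_successors_q ha hb, one_mul]
  rw [stepExp, Finset.sum_congr rfl fun b hb => by rw [key b hb], ← Finset.sum_mul, τ.sum_one,
    one_mul]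

lemma histExp_const (t : ℕ) (c : ℝ) : G.histExp x₁ σ τ t (fun _ => c) = c := by
  induction t with
  | zero => rw [histExp_zero]
  | succ t ih =>
    rw [histExp_succ]
    have : G.stepExp σ τ (fun _ => c) = fun _ => c :=
      funext fun hx => G.stepExp_eq_const σ τ fun _ _ _ => rfl
    rw [this, ih]

variable {G}

/-- The pure strategy of player 2 playing the feasible action `β h x`. -/
def Strategy2.ofPure (β : List (G.X × G.A × G.B) → G.X → G.B)
    (hβ : ∀ h x, β h x ∈ G.actB x) : Strategy2 G where
  play h x b := if b = β h x then 1 else 0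
  nonneg h x b := by split_ifs <;> norm_num
  supp h x b hb := if_neg (by rintro rfl; exact hb (hβ h x))
  sum_one h x := by simp [hβ h x]

/-- A state-dependent strategy of player 1, as a function of the past sequence of states. -/
def Strategy1.statePlay (σ : Strategy1 G) (s : List G.X) (x : G.X) (a : G.A) : ℝ :=
  σ.play (s.map fun y => (y, (G.actA_nonempty y).choose, (G.actB_nonempty y).choose)) x a

lemma Strategy1.stateDep.play_eq {σ : Strategy1 G} (hσ : σ.stateDep)
    (h : List (G.X × G.A × G.B)) (x : G.X) (a : G.A) :
    σ.play h x a = σ.statePlay (h.map Prod.fst) x a := by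
  rw [statePlay, hσ h _ x]
  simp [Function.comp_def]

/-- Expected continuation payoff `w` on the next state, when player 1 plays `σ` and player 2
plays the action `b`, after the past states `s` and at the current state `x`. -/
def Strategy1.actionValue (σ : Strategy1 G) (w : List G.X → G.X → ℝ) (s : List G.X) (x : G.X)
    (b : G.B) : ℝ :=
  ∑ a ∈ G.actA x, σ.statePlay s x a * ∑ y ∈ G.successors x, G.q x a b y * w (s ++ [x]) y

/-- Worst-case expected continuation payoff over the actions of player 2. -/
def Strategy1.contValue (σ : Strategy1 G) (w : List G.X → G.X → ℝ) (s : List G.X) (x : G.X) : ℝ :=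
  (G.actB x).inf' (G.actB_nonempty x) (σ.actionValue w s x)

lemma Strategy1.exists_actionValue_eq (σ : Strategy1 G) (w : List G.X → G.X → ℝ) (s : List G.X)
    (x : G.X) : ∃ b ∈ G.actB x, σ.actionValue w s x b = σ.contValue w s x := by
  obtain ⟨b, hb, h⟩ := Finset.exists_mem_eq_inf' (G.actB_nonempty x) (σ.actionValue w s x)
  exact ⟨b, hb, h.symm⟩

/-- Value of the `k + 1`-stage problem in which player 1 plays `σ` and, at each stage, may stop
and receive `r` at the current state; `s` is the list of past states. -/
def Strategy1.stopValue (σ : Strategy1 G) (r : G.X → ℝ) : ℕ → List G.X → G.X → ℝ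
  | 0, _, x => r x
  | k + 1, s, x => max (r x) (σ.contValue (stopValue σ r k) s x)

variable {σ τ}

lemma stepExp_eq_sum_actionValue (hσ : σ.stateDep) (w : List G.X → G.X → ℝ)
    (hx : List (G.X × G.A × G.B) × G.X) :
    G.stepExp σ τ (fun hy => w (hy.1.map Prod.fst) hy.2) hx =
      ∑ b ∈ G.actB hx.2, τ.play hx.1 hx.2 b *
        σ.actionValue w (hx.1.map Prod.fst) hx.2 b := by
  simp only [stepExp, Strategy1.actionValue, hσ.play_eq, List.map_append, List.map_cons,
    List.map_nil]

lemma contValue_le_stepExp (hσ : σ.stateDep) (w : List G.X → G.X → ℝ)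
    (hx : List (G.X × G.A × G.B) × G.X) :
    σ.contValue w (hx.1.map Prod.fst) hx.2 ≤
      G.stepExp σ τ (fun hy => w (hy.1.map Prod.fst) hy.2) hx := by
  rw [stepExp_eq_sum_actionValue hσ, ← one_mul (σ.contValue _ _ _), ← τ.sum_one hx.1 hx.2,
    Finset.sum_mul]
  exact Finset.sum_le_sum fun b hb =>
    mul_le_mul_of_nonneg_left (Finset.inf'_le _ hb) (τ.nonneg _ _ _)

end StocGame

section StoppingTime

variable {α : Type*} (D : List α → Prop) (n : ℕ)

lemma exists_stopping_stage (s : List α) :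
    ∃ m, 1 ≤ m ∧ (n ≤ m ∨ (m ≤ s.length ∧ D (s.take m))) :=
  ⟨n + 1, by omega, Or.inl (by omega)⟩

/-- The first stage at which `D` holds for the current sequence, capped at `n`. -/
def firstStop (s : List α) : ℕ := Nat.find (exists_stopping_stage D n s)

lemma one_le_firstStop (s : List α) : 1 ≤ firstStop D n s :=
  (Nat.find_spec (exists_stopping_stage D n s)).1

lemma firstStop_le (hn : 1 ≤ n) (s : List α) : firstStop D n s ≤ n :=
  Nat.find_min' _ ⟨hn, Or.inl le_rfl⟩

lemma firstStop_congr {s s' : List α} {m : ℕ} (hs : m ≤ s.length) (hs' : m ≤ s'.length)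
    (h : s.take m = s'.take m) (hm : firstStop D n s = m) : firstStop D n s' = m := by
  have htake : ∀ j ≤ m, s.take j = s'.take j := fun j hj => by
    have := congrArg (List.take j) h
    rwa [List.take_take, List.take_take, min_eq_left hj] at this
  have hiff : ∀ j ≤ m, ((1 ≤ j ∧ (n ≤ j ∨ (j ≤ s.length ∧ D (s.take j)))) ↔
      (1 ≤ j ∧ (n ≤ j ∨ (j ≤ s'.length ∧ D (s'.take j))))) := fun j hj => by
    rw [htake j hj]
    simp only [hj.trans hs, hj.trans hs', true_and]
  rw [firstStop, Nat.find_eq_iff] at hm ⊢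
  exact ⟨(hiff m le_rfl).1 hm.1, fun j hj hc => hm.2 j hj ((hiff j hj.le).2 hc)⟩

lemma firstStop_append_singleton {s : List α} (y : α) (h : firstStop D n s ≤ s.length) :
    firstStop D n (s ++ [y]) = firstStop D n s :=
  firstStop_congr D n h (by simp; omega) (by rw [List.take_append_of_le_length h]) rfl

lemma length_lt_firstStop_append_singleton {s : List α} (y : α)
    (h : s.length < firstStop D n s) : s.length < firstStop D n (s ++ [y]) := by
  by_contra! hc
  have := firstStop_congr D n (s' := s) (by simp; omega) hc
    (by rw [List.take_append_of_le_length hc]) rfl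
  omega

lemma of_firstStop_eq_length {s : List α} (hn : s.length < n) (h : firstStop D n s = s.length) :
    D s := by
  have := (Nat.find_spec (exists_stopping_stage D n s)).2
  rw [← firstStop, h, List.take_length] at this
  exact this.elim (fun h' => absurd h' (by omega)) And.right

lemma not_of_length_lt_firstStop {s : List α} (hs : 1 ≤ s.length)
    (h : s.length < firstStop D n s) : ¬ D s := fun hD =>
  Nat.find_min (exists_stopping_stage D n s) h ⟨hs, Or.inr ⟨le_rfl, by rwa [List.take_length]⟩⟩

end StoppingTime

namespace StocGame

variable {G : StocGame} {σ : Strategy1 G}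

lemma stateSeq_length (hx : List (G.X × G.A × G.B) × G.X) :
    (stateSeq hx).length = hx.1.length + 1 := by
  simp [stateSeq]

lemma stateSeq_concat (hx : List (G.X × G.A × G.B) × G.X) (a : G.A) (b : G.B) (y : G.X) :
    stateSeq (hx.1 ++ [(hx.2, a, b)], y) = stateSeq hx ++ [y] := by
  simp [stateSeq]

/-- Stopping is optimal for player 1 in the `n`-stage stopping problem at the last state of the
given sequence. -/
def Strategy1.shouldStop (σ : Strategy1 G) (r : G.X → ℝ) (n : ℕ) (s : List G.X) : Prop :=
  ∃ s' x, s = s' ++ [x] ∧ σ.contValue (σ.stopValue r (n - s.length - 1)) s' x ≤ r x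

/-- The optimal stopping time guarantees the value of the stopping problem. -/
lemma stopValue_le_histExp_firstStop (hσ : σ.stateDep) (τ : Strategy2 G) (x₁ : G.X) (r : G.X → ℝ)
    (N : ℕ) :
    σ.stopValue r N [] x₁ ≤ G.histExp x₁ σ τ N fun hx =>
      r ((stateSeq hx).getD (firstStop (σ.shouldStop r (N + 1)) (N + 1) (stateSeq hx) - 1)
        hx.2) := by
  set θ := firstStop (σ.shouldStop r (N + 1)) (N + 1) with hθ
  have hlast : ∀ hx : List (G.X × G.A × G.B) × G.X, ∀ j, hx.1.length ≤ j →
      (stateSeq hx).getD j hx.2 = hx.2 := by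
    intro hx j hj
    rcases hj.eq_or_lt with rfl | hj
    · simp [stateSeq]
    · rw [List.getD_eq_default]
      rw [stateSeq_length]; omega
  let Z : ℕ → List (G.X × G.A × G.B) × G.X → ℝ := fun t hx =>
    if θ (stateSeq hx) ≤ t then r ((stateSeq hx).getD (θ (stateSeq hx) - 1) hx.2)
    else σ.stopValue r (N - t) (hx.1.map Prod.fst) hx.2
  have hZ : ∀ t, t < N → ∀ hx : List (G.X × G.A × G.B) × G.X, hx.1.length = t →
      Z t hx ≤ G.stepExp σ τ (Z (t + 1)) hx := by
    intro t ht hx hl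
    have hlen : (stateSeq hx).length = t + 1 := by rw [stateSeq_length, hl]
    by_cases hle : θ (stateSeq hx) ≤ t + 1
    · have hpos : 1 ≤ θ (stateSeq hx) := one_le_firstStop _ _ _
      have hc : G.stepExp σ τ (Z (t + 1)) hx =
          r ((stateSeq hx).getD (θ (stateSeq hx) - 1) hx.2) := by
        refine G.stepExp_eq_const σ τ fun a b y => ?_
        have he : θ (stateSeq hx ++ [y]) = θ (stateSeq hx) :=
          firstStop_append_singleton _ _ y (by rw [hlen]; exact hle)
        simp only [Z, stateSeq_concat, he, if_pos hle]
        congr 1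
        rw [List.getD_append _ _ _ _ (by omega), List.getD_eq_getElem _ _ (by omega),
          List.getD_eq_getElem _ _ (by omega)]
      rw [hc]
      by_cases hle' : θ (stateSeq hx) ≤ t
      · simp only [Z, if_pos hle', le_refl]
      · have heq : θ (stateSeq hx) = t + 1 := by omega
        obtain ⟨s', x, hs, hcv⟩ := of_firstStop_eq_length _ _ (by omega) (heq.trans hlen.symm)
        obtain ⟨rfl, hx2⟩ := List.append_inj' hs rfl
        obtain rfl : hx.2 = x := by simpa using hx2
        simp only [Z, if_neg hle']
        rw [hlast hx _ (by omega)]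
        rw [hlen] at hcv
        obtain ⟨k, rfl⟩ : ∃ k, N = t + k + 1 := ⟨N - t - 1, by omega⟩
        rw [show t + k + 1 + 1 - (t + 1) - 1 = k by omega] at hcv
        rw [show t + k + 1 - t = k + 1 by omega, Strategy1.stopValue]
        exact max_le le_rfl hcv
    · push Not at hle
      have hnot := not_of_length_lt_firstStop (σ.shouldStop r (N + 1)) (N + 1)
        (s := stateSeq hx) (by omega) (by rw [hlen]; exact hle)
      have hcont : r hx.2 < σ.contValue (σ.stopValue r (N - (t + 1))) (hx.1.map Prod.fst) hx.2 := by
        by_contra! hc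
        refine hnot ⟨_, _, rfl, ?_⟩
        rwa [hlen, show N + 1 - (t + 1) - 1 = N - (t + 1) by omega]
      have hstep : G.stepExp σ τ (Z (t + 1)) hx =
          G.stepExp σ τ (fun hy => σ.stopValue r (N - (t + 1)) (hy.1.map Prod.fst) hy.2) hx := by
        unfold stepExp
        have : ∀ a b y, Z (t + 1) (hx.1 ++ [(hx.2, a, b)], y) =
            σ.stopValue r (N - (t + 1)) ((hx.1 ++ [(hx.2, a, b)]).map Prod.fst) y := by
          intro a b y
          have hlt := length_lt_firstStop_append_singleton (σ.shouldStop r (N + 1)) (N + 1)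
            (s := stateSeq hx) y (by rw [hlen]; exact hle)
          rw [hlen, ← hθ] at hlt
          simp only [Z, stateSeq_concat, if_neg (not_le.2 hlt)]
        simp only [this]
      rw [hstep]
      refine le_trans (le_of_eq ?_) (contValue_le_stepExp hσ _ hx)
      simp only [Z]
      rw [if_neg (by omega), show N - t = N - (t + 1) + 1 by omega, Strategy1.stopValue,
        max_eq_right hcont.le]
  have hmono : ∀ t ≤ N, σ.stopValue r N [] x₁ ≤ G.histExp x₁ σ τ t (Z t) := by
    intro t
    induction t with
    | zero =>
      intro _
      have : ¬ θ (stateSeq (([], x₁) : List (G.X × G.A × G.B) × G.X)) ≤ 0 :=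
        not_le.2 (one_le_firstStop _ _ _)
      rw [histExp_zero]
      simp only [Z, if_neg this, List.map_nil, Nat.sub_zero, le_refl]
    | succ t ih =>
      intro ht
      rw [histExp_succ]
      exact (ih (by omega)).trans (G.histExp_mono x₁ σ τ (hZ t (by omega)))
  refine (hmono N le_rfl).trans (G.histExp_mono x₁ σ τ fun hx hl => le_of_eq ?_)
  by_cases hle : θ (stateSeq hx) ≤ N
  · simp only [Z, if_pos hle]
  · simp only [Z, if_neg hle, Nat.sub_self, Strategy1.stopValue]
    rw [hlast hx _ (by omega)]

/-- Player 2 can hold the expected total payoff of `N + 1` stages down to `N + 1` times the value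
of the stopping problem. -/
lemma exists_sum_histExp_le_stopValue (hσ : σ.stateDep) (x₁ : G.X) (r : G.X → ℝ) (N : ℕ) :
    ∃ τ : Strategy2 G, ∑ t ∈ Finset.range (N + 1), G.histExp x₁ σ τ t (fun hx => r hx.2) ≤
      (N + 1 : ℝ) * σ.stopValue r N [] x₁ := by
  choose β hβ hβ' using fun (h : List (G.X × G.A × G.B)) (x : G.X) =>
    σ.exists_actionValue_eq (σ.stopValue r (N - (h.length + 1))) (h.map Prod.fst) x
  refine ⟨.ofPure β hβ, ?_⟩
  set τ := Strategy2.ofPure β hβ with hτ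
  have key : ∀ k j, j + k = N →
      ∑ i ∈ Finset.range (k + 1), G.histExp x₁ σ τ (j + i) (fun hx => r hx.2) ≤
        (k + 1 : ℝ) * G.histExp x₁ σ τ j
          fun hx => σ.stopValue r k (hx.1.map Prod.fst) hx.2 := by
    intro k
    induction k with
    | zero => intro j _; simp [Strategy1.stopValue]
    | succ k ih =>
      intro j hj
      rw [Finset.sum_range_succ']
      have h1 := ih (j + 1) (by omega)
      rw [histExp_succ, ← histExp_const_mul] at h1
      simp only [add_assoc, add_comm 1] at h1
      refine (add_le_add_left h1 _).trans ?_
      rw [add_zero, ← histExp_add, ← histExp_const_mul]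
      refine G.histExp_mono x₁ σ τ fun hx hl => ?_
      have hb : G.stepExp σ τ (fun hy => σ.stopValue r k (hy.1.map Prod.fst) hy.2) hx =
          σ.contValue (σ.stopValue r k) (hx.1.map Prod.fst) hx.2 := by
        rw [stepExp_eq_sum_actionValue hσ, ← show N - (hx.1.length + 1) = k by omega,
          ← hβ' hx.1 hx.2]
        simp [hτ, Strategy2.ofPure, hβ]
      rw [hb, Strategy1.stopValue]
      have h2 := le_max_left (r hx.2) (σ.contValue (σ.stopValue r k) (hx.1.map Prod.fst) hx.2)
      have h3 := le_max_right (r hx.2) (σ.contValue (σ.stopValue r k) (hx.1.map Prod.fst) hx.2)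
      push_cast
      nlinarith [mul_le_mul_of_nonneg_left h3 (by positivity : (0 : ℝ) ≤ (k : ℝ) + 1)]
  have := key N 0 (zero_add N)
  simpa [histExp_zero] using this

end StocGame

namespace RecGame

variable (G : RecGame)

lemma g_eq_stateg (x : G.X) (a : G.A) (b : G.B) : G.g x a b = G.stateg x := by
  by_cases hx : G.absorbing x
  · exact G.absorbing_g _ _ _ _ _ hx
  · rw [stateg, G.g_active _ _ _ hx, G.g_active _ _ _ hx]

lemma stagePayoff_succ_eq_histExp (x₁ : G.X) (σ : G.toStocGame.Strategy1)
    (τ : G.toStocGame.Strategy2) (t : ℕ) :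
    G.toStocGame.stagePayoff x₁ σ τ (t + 1) =
      G.toStocGame.histExp x₁ σ τ t fun hx => G.stateg hx.2 := by
  rw [StocGame.stagePayoff, ← StocGame.tsum_histProb_eq_histExp]
  refine tsum_congr fun hx => ?_
  have : ∑ a ∈ G.actA hx.2, ∑ b ∈ G.actB hx.2,
      σ.play hx.1 hx.2 a * τ.play hx.1 hx.2 b * G.g hx.2 a b = G.stateg hx.2 := by
    simp only [g_eq_stateg, ← Finset.sum_mul, ← Finset.mul_sum, τ.sum_one, σ.sum_one, mul_one,
      one_mul]
  rw [this]

lemma avgPayoff_eq_sum_histExp (x₁ : G.X) (σ : G.toStocGame.Strategy1)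
    (τ : G.toStocGame.Strategy2) (n : ℕ) :
    G.toStocGame.avgPayoff x₁ σ τ n = (n : ℝ)⁻¹ *
      ∑ t ∈ Finset.range n, G.toStocGame.histExp x₁ σ τ t fun hx => G.stateg hx.2 := by
  rw [StocGame.avgPayoff, Finset.range_eq_Ico, ← Finset.Ico_add_one_right_eq_Icc,
    ← Finset.sum_Ico_add' _ 0 n 1]
  simp only [stagePayoff_succ_eq_histExp]

lemma neg_one_le_avgPayoff (x₁ : G.X) (σ : G.toStocGame.Strategy1)
    (τ : G.toStocGame.Strategy2) {n : ℕ} (hn : 1 ≤ n) :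
    -1 ≤ G.toStocGame.avgPayoff x₁ σ τ n := by
  have hn' : (0 : ℝ) < n := by exact_mod_cast hn
  rw [avgPayoff_eq_sum_histExp, inv_mul_eq_div, le_div_iff₀ hn']
  have : ∀ t ∈ Finset.range n,
      (-1 : ℝ) ≤ G.toStocGame.histExp x₁ σ τ t fun hx => G.stateg hx.2 := fun t _ => by
    rw [← G.toStocGame.histExp_const x₁ σ τ t (-1)]
    exact G.toStocGame.histExp_mono x₁ σ τ fun hx _ => (abs_le.1 (G.g_bdd _ _ _)).1
  simpa [mul_comm] using Finset.card_nsmul_le_sum _ _ _ this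

end RecGame

/-- In a recursive game (where the stage payoff depends only on
the current state: `0` on active states and the absorbing payoff on absorbing
states), fix an active initial state `x₁` and a strategy `σ ∈ Σ̂` of player 1
depending only on the sequence of states. Then for every `n ≥ 1` there is a pure
stopping time `θ` on state sequences, with values in `{1,…,n}`, such that for every
strategy `τ` of player 2, `E_{x₁,σ,τ}[g(x_θ)] ≥ min_{τ'} E_{x₁,σ,τ'}[(1/n) Σ_{t=1}^n g(x_t)]`. -/
theorem exists_pure_stopping_time
    (G : RecGame) (hcount : Countable G.X)
    (x₁ : G.X) (hx₁ : ¬ G.absorbing x₁)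
    (σ : G.toStocGame.Strategy1) (hσ : σ.stateDep) (n : ℕ) (hn : 1 ≤ n) :
    ∃ θ : List G.X → ℕ,
      (∀ s : List G.X, s ≠ [] → 1 ≤ θ s ∧ θ s ≤ n) ∧
      (∀ (s s' : List G.X) (m : ℕ), m ≤ s.length → m ≤ s'.length →
        s.take m = s'.take m → θ s = m → θ s' = m) ∧
      ∀ τ : G.toStocGame.Strategy2,
        (∑' hx : List (G.X × G.A × G.B) × G.X,
          if hx.1.length + 1 = n then
            G.toStocGame.histProb x₁ σ τ hx.1 hx.2 *
              G.stateg ((StocGame.stateSeq hx).getD (θ (StocGame.stateSeq hx) - 1) hx.2)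
          else 0) ≥
        ⨅ τ' : G.toStocGame.Strategy2, G.toStocGame.avgPayoff x₁ σ τ' n := by
  obtain ⟨N, rfl⟩ : ∃ N, n = N + 1 := ⟨n - 1, by omega⟩
  refine ⟨firstStop (σ.shouldStop G.stateg (N + 1)) (N + 1),
    fun s _ => ⟨one_le_firstStop _ _ s, firstStop_le _ _ hn s⟩,
    fun s s' m hs hs' h hm => firstStop_congr _ _ hs hs' h hm, fun τ => ?_⟩
  rw [G.toStocGame.tsum_histProb_eq_histExp x₁ σ τ N]
  refine le_trans ?_ (StocGame.stopValue_le_histExp_firstStop hσ τ x₁ G.stateg N)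
  obtain ⟨τ', hτ'⟩ := StocGame.exists_sum_histExp_le_stopValue hσ x₁ G.stateg N
  refine (ciInf_le ⟨-1, ?_⟩ τ').trans ?_
  · rintro _ ⟨τ'', rfl⟩
    exact G.neg_one_le_avgPayoff x₁ σ τ'' hn
  · rw [G.avgPayoff_eq_sum_histExp, inv_mul_le_iff₀ (by positivity)]
    push_cast
    exact hτ'
end
end
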